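/- Let ρ, σ be positive definite density matrices and p ∈ (2,∞). Then the supremum over positive definite density matrices ω of Tr(ρ^{1/2} σ^{2/p−1} ρ^{1/2} ω^{1−2/p}) equals (Tr[(ρ^{1/2} σ^{2/p−1} ρ^{1/2})^{p/2}])^{2/p}, and is attained uniquely at ω_* = Y^{p/2}/Tr(Y^{p/2}) with Y = ρ^{1/2} σ^{2/p−1} ρ^{1/2}. -/

import Mathlib

open Matrix ComplexOrder

/-- Real power of a (Hermitian, in practice positive definite) matrix via spectral calculus. -/
noncomputable def mpow {m : Type*} [Fintype m] [DecidableEq m]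
    (A : Matrix m m ℂ) (r : ℝ) : Matrix m m ℂ :=
  if h : A.IsHermitian then
    (h.eigenvectorUnitary : Matrix m m ℂ) *
      Matrix.diagonal (fun i => ((h.eigenvalues i ^ r : ℝ) : ℂ)) *
      star (h.eigenvectorUnitary : Matrix m m ℂ)
  else A

/-- conjugated real diagonal -/
noncomputable def udu {n : ℕ} (U : Matrix (Fin n) (Fin n) ℂ) (d : Fin n → ℝ) :
    Matrix (Fin n) (Fin n) ℂ :=
  U * Matrix.diagonal (fun i => ((d i : ℝ) : ℂ)) * star U

lemma amgm_eq (a b t s : ℝ) (ha : 0 < a) (hb : 0 < b) (ht : 0 < t) (hs : 0 < s) (hts : t + s = 1) :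
    a ^ t * b ^ s ≤ t * a + s * b ∧ (a ^ t * b ^ s = t * a + s * b ↔ a = b) := by
  refine ⟨Real.geom_mean_le_arith_mean2_weighted ht.le hs.le ha.le hb.le hts, ?_⟩
  have h := Real.geom_mean_eq_arith_mean_weighted_iff_of_pos (Finset.univ : Finset (Fin 2))
    ![t, s] ![a, b] (by simp [Fin.forall_fin_two, ht, hs]) (by simp [hts])
    (by simp [Fin.forall_fin_two, ha.le, hb.le])
  simp [Fin.forall_fin_two, Fin.sum_univ_two, Fin.prod_univ_two] at h
  rw [h]
  constructor
  · rintro ⟨h, -⟩; exact h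
  · intro h; exact ⟨h, h.symm⟩

lemma core_real {n : ℕ} (c : Fin n → Fin n → ℝ) (a w : Fin n → ℝ) (t s : ℝ)
    (hc : ∀ i j, 0 ≤ c i j) (hr : ∀ i, ∑ j, c i j = 1) (hcol : ∀ j, ∑ i, c i j = 1)
    (ha : ∀ i, 0 < a i) (hw : ∀ i, 0 < w i) (ha1 : ∑ i, a i = 1) (hw1 : ∑ i, w i = 1)
    (ht : 0 < t) (hs : 0 < s) (hts : t + s = 1) :
    ∑ i, ∑ j, c i j * (a i ^ t * w j ^ s) ≤ 1 ∧
    (∑ i, ∑ j, c i j * (a i ^ t * w j ^ s) = 1 ↔ ∀ i j, c i j = 0 ∨ a i = w j) := by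
  have h1 : ∑ i, ∑ j, c i j * (t * a i + s * w j) = 1 := by
    have e1 : ∑ i, ∑ j, c i j * (t * a i) = t := by
      simp_rw [← Finset.sum_mul, hr, one_mul, ← Finset.mul_sum, ha1, mul_one]
    have e2 : ∑ i, ∑ j, c i j * (s * w j) = s := by
      rw [Finset.sum_comm]
      simp_rw [← Finset.sum_mul, hcol, one_mul, ← Finset.mul_sum, hw1, mul_one]
    simp_rw [mul_add, Finset.sum_add_distrib, e1, e2, hts]
  have hle : ∀ i j, c i j * (a i ^ t * w j ^ s) ≤ c i j * (t * a i + s * w j) := fun i j =>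
    mul_le_mul_of_nonneg_left (amgm_eq _ _ t s (ha i) (hw j) ht hs hts).1 (hc i j)
  have hle' : ∀ i, ∑ j, c i j * (a i ^ t * w j ^ s) ≤ ∑ j, c i j * (t * a i + s * w j) :=
    fun i => Finset.sum_le_sum fun j _ => hle i j
  refine ⟨h1 ▸ Finset.sum_le_sum fun i _ => hle' i, ?_⟩
  conv_lhs => rw [← h1]
  rw [Finset.sum_eq_sum_iff_of_le fun i _ => hle' i]
  refine forall_congr' fun i => ?_
  simp only [Finset.mem_univ, forall_true_left]
  rw [Finset.sum_eq_sum_iff_of_le fun j _ => hle i j]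
  refine forall_congr' fun j => ?_
  simp only [Finset.mem_univ, forall_true_left]
  rw [mul_eq_mul_left_iff, (amgm_eq _ _ t s (ha i) (hw j) ht hs hts).2, or_comm]

lemma trace_udu {n : ℕ} (U : Matrix (Fin n) (Fin n) ℂ) (d : Fin n → ℝ) (hU : star U * U = 1) :
    (udu U d).trace = ((∑ i, d i : ℝ) : ℂ) := by
  rw [udu, Matrix.trace_mul_comm, ← mul_assoc, hU, one_mul, Matrix.trace_diagonal]
  push_cast; rfl

lemma trace_udu_mul {n : ℕ} (U V : Matrix (Fin n) (Fin n) ℂ) (d e : Fin n → ℝ) :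
    (udu U d * udu V e).trace.re =
      ∑ i, ∑ j, Complex.normSq ((star U * V) i j) * (d i * e j) := by
  have h : (udu U d * udu V e).trace =
      (Matrix.diagonal (fun i => ((d i : ℝ) : ℂ)) * (star U * V) *
        Matrix.diagonal (fun i => ((e i : ℝ) : ℂ)) * star (star U * V)).trace := by
    rw [udu, mul_assoc, mul_assoc, Matrix.trace_mul_comm, udu]
    simp only [star_mul, star_star, mul_assoc]
  rw [h, Matrix.trace, Complex.re_sum]
  refine Finset.sum_congr rfl fun i _ => ?_
  rw [Matrix.diag_apply, Matrix.mul_apply, Complex.re_sum]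
  refine Finset.sum_congr rfl fun j _ => ?_
  rw [Matrix.mul_diagonal, Matrix.diagonal_mul, Matrix.star_apply]
  generalize (star U * V) i j = z
  simp [Complex.normSq_apply]
  ring

lemma core_mat {n : ℕ} (U V : Matrix (Fin n) (Fin n) ℂ) (a w : Fin n → ℝ) (t s : ℝ)
    (hU : star U * U = 1) (hV : star V * V = 1)
    (ha : ∀ i, 0 < a i) (hw : ∀ i, 0 < w i) (ha1 : ∑ i, a i = 1) (hw1 : ∑ i, w i = 1)
    (ht : 0 < t) (hs : 0 < s) (hts : t + s = 1) :
    (udu U (fun i => a i ^ t) * udu V (fun i => w i ^ s)).trace.re ≤ 1 ∧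
    ((udu U (fun i => a i ^ t) * udu V (fun i => w i ^ s)).trace.re = 1 ↔ udu V w = udu U a) := by
  have hU' : U * star U = 1 := mul_eq_one_comm.mp hU
  have hV' : V * star V = 1 := mul_eq_one_comm.mp hV
  have hW : (star U * V) * star (star U * V) = 1 := by
    rw [star_mul, star_star, mul_assoc, ← mul_assoc V, hV', one_mul, hU]
  have hW' : star (star U * V) * (star U * V) = 1 := mul_eq_one_comm.mp hW
  rw [trace_udu_mul]
  have hr : ∀ i, ∑ j, Complex.normSq ((star U * V) i j) = 1 := by
    intro i
    have := congrFun (congrFun hW i) i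
    rw [Matrix.mul_apply] at this
    simp only [Matrix.star_apply, Matrix.one_apply_eq] at this
    have h2 : ∀ z : ℂ, z * star z = (Complex.normSq z : ℂ) := fun z => Complex.mul_conj z
    simp only [h2] at this
    exact_mod_cast this
  have hcol : ∀ j, ∑ i, Complex.normSq ((star U * V) i j) = 1 := by
    intro i
    have := congrFun (congrFun hW' i) i
    rw [Matrix.mul_apply] at this
    simp only [Matrix.star_apply, Matrix.one_apply_eq] at this
    have h2 : ∀ z : ℂ, star z * z = (Complex.normSq z : ℂ) := fun z => by
      rw [mul_comm]; exact Complex.mul_conj z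
    simp only [h2] at this
    exact_mod_cast this
  have := core_real (fun i j => Complex.normSq ((star U * V) i j)) a w t s
    (fun _ _ => Complex.normSq_nonneg _) hr hcol ha hw ha1 hw1 ht hs hts
  refine ⟨this.1, this.2.trans ?_⟩
  have key : (∀ i j, Complex.normSq ((star U * V) i j) = 0 ∨ a i = w j) ↔
      Matrix.diagonal (fun i => ((a i : ℝ) : ℂ)) * (star U * V) =
      (star U * V) * Matrix.diagonal (fun i => ((w i : ℝ) : ℂ)) := by
    rw [← Matrix.ext_iff]
    refine forall_congr' fun i => forall_congr' fun j => ?_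
    rw [Matrix.mul_diagonal, Matrix.diagonal_mul, mul_comm, mul_eq_mul_left_iff,
      Complex.normSq_eq_zero, Complex.ofReal_inj, or_comm]
  rw [key]
  constructor
  · intro h
    have h2 := congrArg (fun M => U * M * star V) h
    simp only [← mul_assoc, hU', one_mul] at h2
    simp only [mul_assoc, hV', mul_one] at h2
    simp only [udu, mul_assoc, h2]
  · intro h
    have h2 := congrArg (fun M => star U * M * V) h
    simp only [udu, ← mul_assoc, hU, one_mul] at h2
    simp only [mul_assoc, hV, mul_one] at h2
    rw [mul_assoc, h2]

lemma mpow_eq {n : ℕ} {A : Matrix (Fin n) (Fin n) ℂ} (h : A.IsHermitian) (r : ℝ) :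
    mpow A r = udu (h.eigenvectorUnitary : Matrix (Fin n) (Fin n) ℂ)
      (fun i => h.eigenvalues i ^ r) := by
  rw [mpow, dif_pos h, udu]

lemma self_eq {n : ℕ} {A : Matrix (Fin n) (Fin n) ℂ} (h : A.IsHermitian) :
    A = udu (h.eigenvectorUnitary : Matrix (Fin n) (Fin n) ℂ) h.eigenvalues := by
  conv_lhs => rw [h.spectral_theorem, Unitary.conjStarAlgAut_apply]
  rfl

lemma posDef_udu {n : ℕ} (U : Matrix (Fin n) (Fin n) ℂ) (d : Fin n → ℝ) (hU : star U * U = 1)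
    (hd : ∀ i, 0 < d i) : (udu U d).PosDef := by
  have hu : IsUnit U := IsUnit.of_mul_eq_one (star U) (mul_eq_one_comm.mp hU)
  rw [udu, hu.posDef_star_right_conjugate_iff, Matrix.posDef_diagonal_iff]
  intro i
  exact_mod_cast hd i

lemma posDef_mpow {n : ℕ} {A : Matrix (Fin n) (Fin n) ℂ} (h : A.PosDef) (r : ℝ) :
    (mpow A r).PosDef := by
  rw [mpow_eq h.1]
  exact posDef_udu _ _ (Unitary.coe_star_mul_self _)
    fun i => Real.rpow_pos_of_pos (h.eigenvalues_pos i) r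

lemma smul_udu {n : ℕ} (U : Matrix (Fin n) (Fin n) ℂ) (d : Fin n → ℝ) (x : ℝ) :
    udu U (fun i => x * d i) = (x : ℂ) • udu U d := by
  have : Matrix.diagonal (fun i => ((x * d i : ℝ) : ℂ)) =
      (x : ℂ) • Matrix.diagonal (fun i => ((d i : ℝ) : ℂ)) := by
    rw [← Matrix.diagonal_smul]; congr 1; ext i; simp
  rw [udu, this, udu, Matrix.mul_smul, Matrix.smul_mul]

lemma main_aux {n : ℕ} (Y : Matrix (Fin n) (Fin n) ℂ) (hY : Y.PosDef) (hn : 0 < n)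
    (p : ℝ) (hp : 2 < p) :
    IsGreatest
      {x : ℝ | ∃ ω : Matrix (Fin n) (Fin n) ℂ, ω.PosDef ∧ ω.trace = 1 ∧
        x = ((Y * mpow ω (1 - 2/p)).trace).re}
      (((mpow Y (p/2)).trace).re ^ (2/p)) ∧
    ∀ ω : Matrix (Fin n) (Fin n) ℂ, ω.PosDef → ω.trace = 1 →
      ((Y * mpow ω (1 - 2/p)).trace).re = ((mpow Y (p/2)).trace).re ^ (2/p) →
      ω = (1 / (mpow Y (p/2)).trace) • mpow Y (p/2) := by
  haveI : Nonempty (Fin n) := ⟨⟨0, hn⟩⟩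
  have hp0 : 0 < p := by linarith
  have ht : 0 < 2 / p := by positivity
  have hs : 0 < 1 - 2 / p := by rw [sub_pos, div_lt_one hp0]; exact hp
  set U : Matrix (Fin n) (Fin n) ℂ := (hY.1.eigenvectorUnitary : Matrix (Fin n) (Fin n) ℂ) with hUdef
  have hU : star U * U = 1 := Unitary.coe_star_mul_self _
  set y := hY.1.eigenvalues with hy
  have hy0 : ∀ i, 0 < y i := hY.eigenvalues_pos
  have hYp : mpow Y (p/2) = udu U (fun i => y i ^ (p/2)) := mpow_eq hY.1 _
  set T : ℝ := ∑ i, y i ^ (p/2) with hT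
  have hT0 : 0 < T := Finset.sum_pos (fun i _ => Real.rpow_pos_of_pos (hy0 i) _) Finset.univ_nonempty
  have htr : (mpow Y (p/2)).trace = (T : ℂ) := by rw [hYp, trace_udu U _ hU]
  set a : Fin n → ℝ := fun i => T⁻¹ * y i ^ (p/2) with ha
  have ha0 : ∀ i, 0 < a i := fun i => mul_pos (inv_pos.mpr hT0) (Real.rpow_pos_of_pos (hy0 i) _)
  have ha1 : ∑ i, a i = 1 := by
    rw [ha, ← Finset.mul_sum, ← hT, inv_mul_cancel₀ hT0.ne']
  have hstar : (1 / (mpow Y (p/2)).trace) • mpow Y (p/2) = udu U a := by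
    rw [ha, smul_udu, htr, hYp]; simp
  have hya : y = fun i => T ^ (2/p) * a i ^ (2/p) := by
    ext i
    rw [ha]
    simp only
    rw [Real.mul_rpow (inv_pos.mpr hT0).le (Real.rpow_pos_of_pos (hy0 i) _).le,
      ← Real.rpow_mul (hy0 i).le, Real.inv_rpow hT0.le]
    have : p / 2 * (2 / p) = 1 := by field_simp
    rw [this, Real.rpow_one, mul_inv_cancel_left₀ (Real.rpow_pos_of_pos hT0 _).ne']
  have hYY : Y = ((T ^ (2/p) : ℝ) : ℂ) • udu U (fun i => a i ^ (2/p)) := by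
    rw [← smul_udu, ← hya]; exact self_eq hY.1
  have hTp : 0 < T ^ (2/p) := Real.rpow_pos_of_pos hT0 _
  have main : ∀ ω : Matrix (Fin n) (Fin n) ℂ, ω.PosDef → ω.trace = 1 →
      ((Y * mpow ω (1 - 2/p)).trace).re ≤ T ^ (2/p) ∧
      (((Y * mpow ω (1 - 2/p)).trace).re = T ^ (2/p) ↔ ω = udu U a) := by
    intro ω hω h1
    have hV : star (hω.1.eigenvectorUnitary : Matrix (Fin n) (Fin n) ℂ) *
      (hω.1.eigenvectorUnitary : Matrix (Fin n) (Fin n) ℂ) = 1 := Unitary.coe_star_mul_self _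
    have hw1 : ∑ i, hω.1.eigenvalues i = 1 := by
      have h2 := h1
      rw [self_eq hω.1, trace_udu _ _ hV] at h2
      exact_mod_cast h2
    have hc := core_mat U (hω.1.eigenvectorUnitary : Matrix (Fin n) (Fin n) ℂ) a hω.1.eigenvalues
      (2/p) (1 - 2/p) hU hV ha0 hω.eigenvalues_pos ha1 hw1 ht hs (by ring)
    rw [← self_eq hω.1, ← mpow_eq hω.1] at hc
    have e : ((Y * mpow ω (1 - 2/p)).trace).re =
        T ^ (2/p) * (udu U (fun i => a i ^ (2/p)) * mpow ω (1 - 2/p)).trace.re := by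
      conv_lhs => rw [hYY, Matrix.smul_mul, Matrix.trace_smul, smul_eq_mul, Complex.re_ofReal_mul]
    rw [e, ← hc.2]
    exact ⟨mul_le_of_le_one_right hTp.le hc.1, mul_eq_left₀ hTp.ne'⟩
  rw [hstar, htr, Complex.ofReal_re]
  have hpd := posDef_udu U a hU ha0
  have htr1 : (udu U a).trace = 1 := by rw [trace_udu U a hU, ha1]; simp
  refine ⟨⟨⟨udu U a, hpd, htr1, ((main _ hpd htr1).2.mpr rfl).symm⟩, ?_⟩, ?_⟩
  · rintro x ⟨ω, hω, h1, rfl⟩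
    exact (main ω hω h1).1
  · intro ω hω h1 h
    exact (main ω hω h1).2.mp h

/-- For `p ∈ (2,∞)`, the supremum over positive definite density matrices `ω` of
`Tr(ρ^{1/2} σ^{2/p−1} ρ^{1/2} ω^{1−2/p})` equals `(Tr[(ρ^{1/2}σ^{2/p−1}ρ^{1/2})^{p/2}])^{2/p}`,
attained uniquely at `ω_* = Y^{p/2}/Tr(Y^{p/2})`. -/
theorem araki_masuda_sup {n : ℕ} (ρ σ : Matrix (Fin n) (Fin n) ℂ)
    (hρ : ρ.PosDef) (hσ : σ.PosDef) (hρ1 : ρ.trace = 1) (hσ1 : σ.trace = 1)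
    (p : ℝ) (hp : 2 < p) :
    letI Y : Matrix (Fin n) (Fin n) ℂ := mpow ρ (1/2) * mpow σ (2/p - 1) * mpow ρ (1/2)
    IsGreatest
      {x : ℝ | ∃ ω : Matrix (Fin n) (Fin n) ℂ, ω.PosDef ∧ ω.trace = 1 ∧
        x = ((Y * mpow ω (1 - 2/p)).trace).re}
      (((mpow Y (p/2)).trace).re ^ (2/p)) ∧
    ∀ ω : Matrix (Fin n) (Fin n) ℂ, ω.PosDef → ω.trace = 1 →
      ((Y * mpow ω (1 - 2/p)).trace).re = ((mpow Y (p/2)).trace).re ^ (2/p) →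
      ω = (1 / (mpow Y (p/2)).trace) • mpow Y (p/2) := by

  have hn : 0 < n := by
    rcases Nat.eq_zero_or_pos n with h | h
    · subst h
      simp [Matrix.trace] at hρ1
    · exact h
  refine main_aux _ ?_ hn p hp
  have hA := posDef_mpow hρ (1/2)
  have hB := posDef_mpow hσ (2/p - 1)
  have h := (hA.isUnit.posDef_star_right_conjugate_iff).mpr hB
  rwa [Matrix.star_eq_conjTranspose, hA.1.eq] at h
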